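/- Suppose ℓ(s_i∘w_1) > ℓ(w_1) and ℓ(s_i∘w_2) > ℓ(w_2). Then (1−t)·D_i^{(4)}(Z(w_1,w_2)) = t·σ_i(Z(s_i∘w_1, w_2)) − t·Z(w_1, s_i∘w_2) in K(z_1,…,z_r). -/

import Mathlib

/-- A spin: `Sum.inl a` is the color `c_{a+1}`, `Sum.inr b` is the dolor `d_{b+1}`
(so indices are 0-based). -/
abbrev Spin (r : ℕ) := Fin r ⊕ Fin r

/-- The `k`-th boson (0-indexed) in the monochrome ordering:
`(c_a, d_b) < (c_{a'}, d_{b'})` iff `b > b'`, or `b = b'` and `a < a'`.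
A boson is recorded as the pair (color index, dolor index), 0-based. -/
def bosonOfIdx {r : ℕ} (k : Fin (r * r)) : Fin r × Fin r :=
  have hr : 0 < r := by
    rcases Nat.eq_zero_or_pos r with h | h
    · exact absurd k.2 (by simp [h])
    · exact h
  (⟨k.val % r, Nat.mod_lt _ hr⟩,
   ⟨r - 1 - k.val / r, lt_of_le_of_lt (Nat.sub_le _ _) (Nat.sub_lt hr one_pos)⟩)

/-- One admissibility step at boson `ab = (a,b)`, from spin `x` to spin `y`,
where `m` is the multiplicity function on the top edge and `m'` on the bottom edge:
either a pass, a split, or a merge. -/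
def StepOK {r : ℕ} (m m' : Fin r × Fin r → ℕ) (ab : Fin r × Fin r)
    (x y : Spin r) : Prop :=
  (y = x ∧ m' ab = m ab) ∨
  (x = Sum.inr ab.2 ∧ y = Sum.inl ab.1 ∧ m ab = m' ab + 1) ∨
  (x = Sum.inl ab.1 ∧ y = Sum.inr ab.2 ∧ m' ab = m ab + 1)

/-- Admissibility of a vertex datum: left spin `l`, top multiplicities `m`,
right spin `rr`, bottom multiplicities `m'`. -/
def AdmissibleVertex {r : ℕ} (l : Spin r) (m : Fin r × Fin r → ℕ) (rr : Spin r)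
    (m' : Fin r × Fin r → ℕ) : Prop :=
  ∃ x : Fin (r * r + 1) → Spin r, x 0 = l ∧ x (Fin.last _) = rr ∧
    ∀ k : Fin (r * r), StepOK m m' (bosonOfIdx k) (x k.castSucc) (x k.succ)

/-- The coefficient ring `ℤ[t][z_1,…,z_r]`, with `t = X none` and `z_{i+1} = X (some i)`. -/
abbrev PolyR (r : ℕ) := MvPolynomial (Option (Fin r)) ℤ

/-- The variable `t`. -/
noncomputable def tP (r : ℕ) : PolyR r := MvPolynomial.X none

/-- The variable `z_{i+1}`. -/
noncomputable def zP {r : ℕ} (i : Fin r) : PolyR r := MvPolynomial.X (some i)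

/-- Weight of a pass step at boson `ab`, where the horizontal spin is `x`,
`n` is the number of bosons on the (equal) vertical edges, and `zi` is the row parameter. -/
noncomputable def passWeight {r : ℕ} (zi : PolyR r) (n : ℕ) (ab : Fin r × Fin r)
    (x : Spin r) : PolyR r :=
  match x with
  | Sum.inl e => if e = ab.1 then zi else if e < ab.1 then tP r ^ n else 1
  | Sum.inr e =>
      if e = ab.2 then 1
      else if ab.1.val = 0 then (if e < ab.2 then tP r ^ n * zi else zi)
      else (if e < ab.2 then tP r ^ n else 1)

/-- Weight of the step at boson `ab` with top multiplicity `m`, bottom multiplicity `m'`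
and incoming horizontal spin `x`. -/
noncomputable def stepWeight {r : ℕ} (zi : PolyR r) (m m' : ℕ) (ab : Fin r × Fin r)
    (x : Spin r) : PolyR r :=
  if m = m' + 1 then ∑ j ∈ Finset.range (min m m' + 1), tP r ^ j
  else if m' = m + 1 then (1 - tP r) * zi
  else passWeight zi (min m m') ab x

/-- The (necessarily unique) next horizontal spin at a boson `ab`. -/
def nextSpin {r : ℕ} (m m' : Fin r × Fin r → ℕ) (ab : Fin r × Fin r) (x : Spin r) : Spin r :=
  if m ab = m' ab + 1 then Sum.inl ab.1
  else if m' ab = m ab + 1 then Sum.inr ab.2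
  else x

/-- The sequence of horizontal spins inside a vertex, starting from the left spin `l`.
For an admissible vertex this coincides with the unique admissibility sequence. -/
def pathSpin {r : ℕ} (m m' : Fin r × Fin r → ℕ) (l : Spin r) : ℕ → Spin r
  | 0 => l
  | k + 1 =>
      if h : k < r * r then nextSpin m m' (bosonOfIdx ⟨k, h⟩) (pathSpin m m' l k)
      else pathSpin m m' l k

/-- Boltzmann weight of an admissible vertex with row parameter `zi`, left spin `l`,
top multiplicities `m` and bottom multiplicities `m'`. -/
noncomputable def vertexWeight {r : ℕ} (zi : PolyR r) (l : Spin r)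
    (m m' : Fin r × Fin r → ℕ) : PolyR r :=
  ∏ k : Fin (r * r),
    stepWeight zi (m (bosonOfIdx k)) (m' (bosonOfIdx k)) (bosonOfIdx k)
      (pathSpin m m' l k.val)

open Classical in
/-- `W(l, m, rr, m')`: the weight of the vertex datum if admissible, and `0` otherwise. -/
noncomputable def Wvert {r : ℕ} (zi : PolyR r) (l : Spin r) (m : Fin r × Fin r → ℕ)
    (rr : Spin r) (m' : Fin r × Fin r → ℕ) : PolyR r :=
  if AdmissibleVertex l m rr m' then vertexWeight zi l m m' else 0

/-- A filling of the `r × N` grid: `m i j` are the boson multiplicities on the vertical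
edge of column `j` between rows `i` and `i+1` (row `0` is the top boundary),
and `h i j` is the horizontal spin of row `i+1` immediately to the right of column `j`
(`j = N` is the left boundary, `j = 0` the right boundary). -/
structure Filling (r N : ℕ) where
  m : Fin (r + 1) → Fin N → Fin r × Fin r → ℕ
  h : Fin r → Fin (N + 1) → Spin r

/-- A state: every vertex is admissible. -/
def Filling.IsState {r N : ℕ} (f : Filling r N) : Prop :=
  ∀ (i : Fin r) (j : Fin N),
    AdmissibleVertex (f.h i j.succ) (f.m i.castSucc j) (f.h i j.castSucc) (f.m i.succ j)

/-- Membership in the system `S(λ; w_1, w_2, w_3, w_4)`. -/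
def InSystem {r N : ℕ} (lam : Fin r → ℕ) (w1 w2 w3 w4 : Equiv.Perm (Fin r))
    (f : Filling r N) : Prop :=
  f.IsState ∧
  (∀ (j : Fin N) (a b : Fin r),
      f.m 0 j (a, b) =
        (Finset.univ.filter fun i : Fin r =>
            lam i = j.val ∧ w3⁻¹ i = a ∧ w4⁻¹ (Fin.rev i) = b).card) ∧
  (∀ (j : Fin N) (ab : Fin r × Fin r), f.m (Fin.last r) j ab = 0) ∧
  (∀ i : Fin r, f.h i 0 = Sum.inl (w1⁻¹ i)) ∧
  (∀ i : Fin r, f.h i (Fin.last N) = Sum.inr (w2⁻¹ i))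

/-- The Boltzmann weight of a state: the product of the weights of its vertices. -/
noncomputable def stateWeight {r N : ℕ} (f : Filling r N) : PolyR r :=
  ∏ i : Fin r, ∏ j : Fin N,
    vertexWeight (zP i) (f.h i j.succ) (f.m i.castSucc j) (f.m i.succ j)

open Classical in
/-- The partition function `Z(λ; w_1, w_2, w_3, w_4)`: the sum of the weights of the
states of the system (a finite sum, expressed via `finsum`). -/
noncomputable def partitionZ (r N : ℕ) (lam : Fin r → ℕ)
    (w1 w2 w3 w4 : Equiv.Perm (Fin r)) : PolyR r :=
  finsum fun f : Filling r N =>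
    if InSystem lam w1 w2 w3 w4 f then stateWeight f else 0

/-- The state `f` has a merge at vertex `(i+1, j)`. -/
def HasMergeAt {r N : ℕ} (f : Filling r N) (i : Fin r) (j : Fin N) : Prop :=
  ∃ ab : Fin r × Fin r, f.m i.castSucc j ab < f.m i.succ j ab

/-- `ℓ(w)`: the number of inversions of a permutation. -/
def invCount {r : ℕ} (w : Equiv.Perm (Fin r)) : ℕ :=
  (Finset.univ.filter fun p : Fin r × Fin r => p.1 < p.2 ∧ w p.2 < w p.1).card

/-- A transposition in `S_r`. -/
def IsTransposition {r : ℕ} (t : Equiv.Perm (Fin r)) : Prop :=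
  ∃ a b : Fin r, a ≠ b ∧ t = Equiv.swap a b

/-- Bruhat order on `S_r`. -/
def bruhatLE {r : ℕ} (u v : Equiv.Perm (Fin r)) : Prop :=
  Relation.ReflTransGen
    (fun x y => ∃ t, IsTransposition t ∧ y = x * t ∧ invCount x < invCount y) u v

/-- The field `K = ℚ(t)`. -/
abbrev Kt := RatFunc ℚ

/-- The field `K(z_1,…,z_r)` of rational functions over `K = ℚ(t)`. -/
abbrev FFld (r : ℕ) := FractionRing (MvPolynomial (Fin r) Kt)

/-- The variable `z_{i+1}` in `K(z_1,…,z_r)`. -/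
noncomputable def zF {r : ℕ} (i : Fin r) : FFld r :=
  algebraMap (MvPolynomial (Fin r) Kt) (FFld r) (MvPolynomial.X i)

/-- The element `t` in `K(z_1,…,z_r)`. -/
noncomputable def tF (r : ℕ) : FFld r :=
  algebraMap (MvPolynomial (Fin r) Kt) (FFld r) (MvPolynomial.C RatFunc.X)

/-- The canonical ring homomorphism `ℤ[t][z_1,…,z_r] → K(z_1,…,z_r)`. -/
noncomputable def toFF (r : ℕ) : PolyR r →+* FFld r :=
  MvPolynomial.eval₂Hom (Int.castRingHom (FFld r)) fun o => o.elim (tF r) zF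

/-- The K-algebra automorphism `σ` of `K(z_1,…,z_r)` exchanging `z_a` and `z_b` and
fixing the other variables. -/
noncomputable def sigmaF {r : ℕ} (a b : Fin r) : FFld r ≃+* FFld r :=
  IsFractionRing.ringEquivOfRingEquiv
    (MvPolynomial.renameEquiv Kt (Equiv.swap a b)).toRingEquiv

/-- `D^{(1)} f = (z_a - z_b)⁻¹ (z_a f - z_a σ(f))`. -/
noncomputable def DF1 {r : ℕ} (a b : Fin r) (f : FFld r) : FFld r :=
  (zF a - zF b)⁻¹ * (zF a * f - zF a * sigmaF a b f)

/-- `D^{(2)} f = (z_a - z_b)⁻¹ (z_a f - z_b σ(f))`. -/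
noncomputable def DF2 {r : ℕ} (a b : Fin r) (f : FFld r) : FFld r :=
  (zF a - zF b)⁻¹ * (zF a * f - zF b * sigmaF a b f)

/-- `D^{(3)} f = (z_a - z_b)⁻¹ (z_b f - z_a σ(f))`. -/
noncomputable def DF3 {r : ℕ} (a b : Fin r) (f : FFld r) : FFld r :=
  (zF a - zF b)⁻¹ * (zF b * f - zF a * sigmaF a b f)

/-- `D^{(4)} f = (z_a - z_b)⁻¹ (z_b f - z_b σ(f))`. -/
noncomputable def DF4 {r : ℕ} (a b : Fin r) (f : FFld r) : FFld r :=
  (zF a - zF b)⁻¹ * (zF b * f - zF b * sigmaF a b f)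



section AbstractYBE

variable {S K : Type*} [DecidableEq S] [CommRing K]

/-- Abstract one-boson vertex weight. -/
def absL (A D : S) (p : ℕ → S → K) (t z : K) (n n' : ℕ) (x y : S) : K :=
  if x = y then (if n' = n then p n x else 0)
  else if x = D ∧ y = A then (if n = n' + 1 then ∑ j ∈ Finset.range (n' + 1), t ^ j else 0)
  else if x = A ∧ y = D then (if n' = n + 1 then (1 - t) * z else 0)
  else 0

/-- Two stacked abstract vertices. -/
def absQ (A D : S) (p1 p2 : ℕ → S → K) (t z1 z2 : K) (B n n'' : ℕ) (μ ν γ δ : S) : K :=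
  ∑ k ∈ Finset.range B, absL A D p1 t z1 n k μ γ * absL A D p2 t z2 k n'' ν δ

theorem absQ_diag (A D : S) (p1 p2 : ℕ → S → K) (t z1 z2 : K) (B n n'' : ℕ) (hB : n + 2 ≤ B)
    (μ ν δ : S) : absQ A D p1 p2 t z1 z2 B n n'' μ ν μ δ
      = p1 n μ * absL A D p2 t z2 n n'' ν δ := by
  unfold absQ
  rw [Finset.sum_eq_single n]
  · simp [absL]
  · intro k _ hk; simp [absL, hk]
  · intro h; exact absurd (Finset.mem_range.2 (by omega)) h

theorem absQ_split (A D : S) (hAD : A ≠ D) (p1 p2 : ℕ → S → K) (t z1 z2 : K) (B n n'' : ℕ)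
    (hB : n + 2 ≤ B) (ν δ : S) : absQ A D p1 p2 t z1 z2 B n n'' D ν A δ
      = (∑ j ∈ Finset.range n, t ^ j) * absL A D p2 t z2 (n - 1) n'' ν δ := by
  unfold absQ
  rcases n with _ | n
  · simp only [Finset.range_zero, Finset.sum_empty, zero_mul]
    apply Finset.sum_eq_zero
    intro k _
    simp [absL, hAD.symm]
  · rw [Finset.sum_eq_single n]
    · simp [absL, hAD.symm]
    · intro k _ hk
      have : ¬ (n = k) := fun h => hk h.symm
      simp [absL, hAD.symm, this]
    · intro h; exact absurd (Finset.mem_range.2 (by omega)) h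

theorem absQ_merge (A D : S) (hAD : A ≠ D) (p1 p2 : ℕ → S → K) (t z1 z2 : K) (B n n'' : ℕ)
    (hB : n + 2 ≤ B) (ν δ : S) : absQ A D p1 p2 t z1 z2 B n n'' A ν D δ
      = (1 - t) * z1 * absL A D p2 t z2 (n + 1) n'' ν δ := by
  unfold absQ
  rw [Finset.sum_eq_single (n + 1)]
  · simp [absL, hAD]
  · intro k _ hk
    simp [absL, hAD, hk]
  · intro h; exact absurd (Finset.mem_range.2 (by omega)) h

theorem absQ_zero (A D : S) (p1 p2 : ℕ → S → K) (t z1 z2 : K) (B n n'' : ℕ)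
    (μ ν γ δ : S) (h0 : μ ≠ γ) (h1 : ¬ (μ = D ∧ γ = A)) (h2 : ¬ (μ = A ∧ γ = D)) :
    absQ A D p1 p2 t z1 z2 B n n'' μ ν γ δ = 0 := by
  unfold absQ
  apply Finset.sum_eq_zero
  intro k _
  simp [absL, h0, h1, h2]

theorem absQ_eq (A D : S) (hAD : A ≠ D) (p1 p2 : ℕ → S → K) (t z1 z2 : K) (B n n'' : ℕ)
    (hB : n + 2 ≤ B) (μ ν γ δ : S) : absQ A D p1 p2 t z1 z2 B n n'' μ ν γ δ
      = if μ = γ then p1 n μ * absL A D p2 t z2 n n'' ν δ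
        else if μ = D ∧ γ = A then
          (∑ j ∈ Finset.range n, t ^ j) * absL A D p2 t z2 (n - 1) n'' ν δ
        else if μ = A ∧ γ = D then (1 - t) * z1 * absL A D p2 t z2 (n + 1) n'' ν δ
        else 0 := by
  split_ifs with h1 h2 h3
  · subst h1; exact absQ_diag A D p1 p2 t z1 z2 B n n'' hB μ ν δ
  · rw [h2.1, h2.2]; exact absQ_split A D hAD p1 p2 t z1 z2 B n n'' hB ν δ
  · rw [h3.1, h3.2]; exact absQ_merge A D hAD p1 p2 t z1 z2 B n n'' hB ν δ
  · exact absQ_zero A D p1 p2 t z1 z2 B n n'' μ ν γ δ h1 h2 h3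

theorem gs_mul (t : K) (n : ℕ) : (1 - t) * (∑ j ∈ Finset.range n, t ^ j) = 1 - t ^ n := by
  rw [mul_comm]; exact geom_sum_mul_neg t n

set_option maxHeartbeats 4000000 in
theorem absYBE (A D : S) (hAD : A ≠ D) (t z1 z2 c : K)
    (y1 y2 τ : S → K) (T : ℕ → S → K) (p1 p2 : ℕ → S → K)
    (ρ ρ' o : S → S → K)
    (hp1A : ∀ n, p1 n A = z1) (hp1D : ∀ n, p1 n D = 1)
    (hp2A : ∀ n, p2 n A = z2) (hp2D : ∀ n, p2 n D = 1)
    (hp1 : ∀ n x, x ≠ A → x ≠ D → p1 n x = T n x * y1 x)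
    (hp2 : ∀ n x, x ≠ A → x ≠ D → p2 n x = T n x * y2 x)
    (hT : ∀ n x, x ≠ A → x ≠ D → T (n + 1) x = τ x * T n x)
    (hρ : ∀ x, ρ x x = c * (z1 - t * z2)) (hρ' : ∀ x, ρ' x x = c * (z1 - t * z2))
    (ho : ∀ x, o x x = 0)
    (hAD1 : ρ A D = c * ((1 - t) * z2)) (hAD1' : ρ' A D = c * ((1 - t) * z2))
    (hDA1 : ρ D A = c * ((1 - t) * z1)) (hDA1' : ρ' D A = c * ((1 - t) * z1))
    (hADo : o A D = c * (t * (z1 - z2))) (hDAo : o D A = c * (z1 - z2))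
    (hs : ∀ x y, x ≠ A → x ≠ D → y ≠ A → y ≠ D → x ≠ y →
      ρ x y * (y1 x * y2 y) = ρ' x y * (y2 x * y1 y))
    (hxA : ∀ x, x ≠ A → x ≠ D → ρ x A * (y1 x * z2) = ρ' x A * (y2 x * z1))
    (hxD : ∀ x, x ≠ A → x ≠ D → ρ x D * y1 x = ρ' x D * y2 x)
    (hx : ∀ x, x ≠ A → x ≠ D → ρ' x D = ρ' x A)
    (hAx : ∀ x, x ≠ A → x ≠ D → ρ A x * (z1 * y2 x) = ρ' A x * (z2 * y1 x))
    (hDx : ∀ x, x ≠ A → x ≠ D → ρ D x * y2 x = ρ' D x * y1 x)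
    (hx2 : ∀ x, x ≠ A → x ≠ D → ρ' D x = ρ' A x)
    (ho1 : ∀ x, x ≠ A → x ≠ D → o x D = τ x * o x A)
    (ho2 : ∀ x, x ≠ A → x ≠ D → o A x = τ x * o D x)
    (B n n'' : ℕ) (hB : n + 2 ≤ B) (α β γ δ : S) :
    ρ α β * absQ A D p1 p2 t z1 z2 B n n'' α β γ δ
      + o α β * absQ A D p1 p2 t z1 z2 B n n'' β α γ δ
    = ρ' γ δ * absQ A D p2 p1 t z2 z1 B n n'' α β γ δ
      + o δ γ * absQ A D p2 p1 t z2 z1 B n n'' α β δ γ := by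
  simp only [absQ_eq A D hAD _ _ t _ _ B n n'' hB]
  have tri : ∀ x : S, A = x ∨ D = x ∨ (x ≠ A ∧ x ≠ D) := by
    intro x
    by_cases h1 : A = x
    · exact Or.inl h1
    by_cases h2 : D = x
    · exact Or.inr (Or.inl h2)
    exact Or.inr (Or.inr ⟨fun h => h1 h.symm, fun h => h2 h.symm⟩)
  have hDA := hAD.symm
  obtain ⟨k, hk⟩ : ∃ k, k = n - 1 := ⟨_, rfl⟩
  obtain rfl | rfl : n = 0 ∨ n = k + 1 := by omega
  all_goals clear hk
  all_goals
    rcases tri α with rfl | rfl | ⟨hα, hα'⟩ <;> rcases tri β with rfl | rfl | ⟨hβ, hβ'⟩ <;>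
    rcases tri γ with rfl | rfl | ⟨hγ, hγ'⟩ <;> rcases tri δ with rfl | rfl | ⟨hδ, hδ'⟩ <;>
    simp [absL, *, Ne.symm, hAD.symm]
  all_goals have hG := gs_mul t k
  all_goals split_ifs
  all_goals try (exfalso; omega)
  all_goals try subst_vars
  all_goals try (first | rfl | ring1)
  all_goals try simp only [zero_add, Finset.sum_range_succ, Finset.range_zero, Finset.sum_empty]
  all_goals try (first | rfl | ring1)
  all_goals clear ho1 ho2 hT hp1 hp2
  all_goals try (rw [hρ, hρ']; ring1)
  all_goals first
    | (have h := hAx δ ‹_› ‹_›; have h' := hx2 δ ‹_› ‹_›; have h'' := hDx δ ‹_› ‹_›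
       clear hAx hDx hx2 hs hxA hxD hx hρ hρ' ho; grind)
    | (have h := hxA γ ‹_› ‹_›; have h' := hx γ ‹_› ‹_›; have h'' := hxD γ ‹_› ‹_›
       clear hAx hDx hx2 hs hxA hxD hx hρ hρ' ho; grind)
    | (clear hAx hDx hx2 hs hxA hxD hx hρ hρ' ho; grind)
    | skip
  · linear_combination (T 0 γ * T 0 δ) * hs γ δ hγ hγ' hδ hδ' ‹_›
  · linear_combination (τ γ * T k γ * τ δ * T k δ) * hs γ δ hγ hγ' hδ hδ' ‹_›

end AbstractYBE


section ConcreteYBE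

open Matrix Kronecker

/-- One-boson weight matrix. -/
noncomputable def monoM {r : ℕ} (z : PolyR r) (ab : Fin r × Fin r) (n n' : ℕ) :
    Matrix (Spin r) (Spin r) (PolyR r) := fun x y =>
  if (y = x ∧ n' = n) ∨ (x = Sum.inr ab.2 ∧ y = Sum.inl ab.1 ∧ n = n' + 1) ∨
    (x = Sum.inl ab.1 ∧ y = Sum.inr ab.2 ∧ n' = n + 1) then stepWeight z n n' ab x else 0

theorem monoM_eq {r : ℕ} (z : PolyR r) (ab : Fin r × Fin r) (n n' : ℕ) (x y : Spin r) :
    monoM z ab n n' x y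
      = absL (Sum.inl ab.1) (Sum.inr ab.2) (fun n x => passWeight z n ab x) (tP r) z n n' x y := by
  unfold monoM absL stepWeight
  by_cases hxy : x = y
  · subst hxy
    by_cases hn : n' = n
    · subst hn; simp
    · rcases x with x | x <;> simp [hn]
  · rw [if_neg hxy]
    have hyx : ¬ y = x := fun h => hxy h.symm
    by_cases h1 : x = Sum.inr ab.2 ∧ y = Sum.inl ab.1
    · obtain ⟨rfl, rfl⟩ := h1
      by_cases hn : n = n' + 1
      · subst hn; simp
      · simp [hn]
    · rw [if_neg h1]
      by_cases h2 : x = Sum.inl ab.1 ∧ y = Sum.inr ab.2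
      · obtain ⟨rfl, rfl⟩ := h2
        by_cases hn : n' = n + 1
        · subst hn
          have : ¬ (n = n + 1 + 1) := by omega
          simp [this]
        · simp [hn]
      · rw [if_neg h2]
        apply if_neg
        grind

/-- Rotated rank. -/
def rk {r : ℕ} (u : ℕ) (p : Fin r) : ℕ := if u ≤ p.val then p.val else p.val + r

/-- Diagonal part of the (scaled) R-matrix. -/
noncomputable def rhoR {r : ℕ} (z1 z2 : PolyR r) (u β b : ℕ) : Spin r → Spin r → PolyR r
  | Sum.inl e, Sum.inl f => if e = f then z1 * z2 * (z1 - tP r * z2)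
      else z1 * z2 * ((1 - tP r) * (if rk u e < rk u f then z2 else z1))
  | Sum.inr e, Sum.inr f => if e = f then z1 * z2 * (z1 - tP r * z2)
      else z1 * z2 * ((1 - tP r) * (if rk β e < rk β f then z2 else z1))
  | Sum.inl e, Sum.inr f => if 1 ≤ u ∧ u ≤ e.val ∧ f.val ≠ b then (1 - tP r) * z2 ^ 3
      else z1 * z2 * ((1 - tP r) * z2)
  | Sum.inr f, Sum.inl e => if 1 ≤ u ∧ u ≤ e.val ∧ f.val ≠ b then (1 - tP r) * z1 ^ 3
      else z1 * z2 * ((1 - tP r) * z1)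

/-- Off-diagonal part of the (scaled) R-matrix. -/
noncomputable def offR {r : ℕ} (z1 z2 : PolyR r) : Spin r → Spin r → PolyR r
  | Sum.inl e, Sum.inl f => if e = f then 0 else
      if e < f then z1 * z2 * (z1 - z2) else z1 * z2 * (tP r * (z1 - z2))
  | Sum.inr e, Sum.inr f => if e = f then 0 else
      if f < e then z1 * z2 * (z1 - z2) else z1 * z2 * (tP r * (z1 - z2))
  | Sum.inl _, Sum.inr _ => z1 * z2 * (tP r * (z1 - z2))
  | Sum.inr _, Sum.inl _ => z1 * z2 * (z1 - z2)

/-- The R-matrix. -/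
noncomputable def Rmat {r : ℕ} (z1 z2 : PolyR r) (u β b : ℕ) :
    Matrix (Spin r × Spin r) (Spin r × Spin r) (PolyR r) := fun p q =>
  (if q = p then rhoR z1 z2 u β b p.1 p.2 else 0) + (if q = p.swap then offR z1 z2 p.1 p.2 else 0)

theorem Rmat_mul {r : ℕ} (z1 z2 : PolyR r) (u β b : ℕ)
    (M : Matrix (Spin r × Spin r) (Spin r × Spin r) (PolyR r)) (x y : Spin r) (q) :
    (Rmat z1 z2 u β b * M) (x, y) q =
      rhoR z1 z2 u β b x y * M (x, y) q + offR z1 z2 x y * M (y, x) q := by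
  simp [Matrix.mul_apply, Rmat, add_mul, Finset.sum_add_distrib, ite_mul]

theorem mul_Rmat {r : ℕ} (z1 z2 : PolyR r) (u β b : ℕ)
    (M : Matrix (Spin r × Spin r) (Spin r × Spin r) (PolyR r)) (p) (x y : Spin r) :
    (M * Rmat z1 z2 u β b) p (x, y) =
      rhoR z1 z2 u β b x y * M p (x, y) + offR z1 z2 y x * M p (y, x) := by
  have h : ∀ q : Spin r × Spin r, ((x, y) = q.swap) ↔ (q = (y, x)) := by
    rintro ⟨a, b⟩; simp [Prod.ext_iff]; tauto
  have h' : ∀ q : Spin r × Spin r, ((x, y) = q) ↔ (q = (x, y)) := fun q => eq_comm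
  simp [Matrix.mul_apply, Rmat, mul_add, Finset.sum_add_distrib, h, h', mul_comm]

/-- Two stacked one-boson vertices. -/
noncomputable def monoQ {r : ℕ} (z1 z2 : PolyR r) (ab : Fin r × Fin r) (B n n'' : ℕ) :
    Matrix (Spin r × Spin r) (Spin r × Spin r) (PolyR r) :=
  ∑ k ∈ Finset.range B, monoM z1 ab n k ⊗ₖ monoM z2 ab k n''

theorem monoQ_eq {r : ℕ} (z1 z2 : PolyR r) (ab : Fin r × Fin r) (B n n'' : ℕ) (μ ν γ δ : Spin r) :
    monoQ z1 z2 ab B n n'' (μ, ν) (γ, δ)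
      = absQ (Sum.inl ab.1) (Sum.inr ab.2) (fun n x => passWeight z1 n ab x)
        (fun n x => passWeight z2 n ab x) (tP r) z1 z2 B n n'' μ ν γ δ := by
  simp [monoQ, absQ, Matrix.sum_apply, monoM_eq]

theorem monoYBE {r : ℕ} (z1 z2 : PolyR r) (a b : Fin r) (B n n'' : ℕ) (hB : n + 2 ≤ B) :
    Rmat z1 z2 a.val (if a.val = 0 then b.val + 1 else b.val) b.val * monoQ z1 z2 (a, b) B n n''
      = monoQ z2 z1 (a, b) B n n'' * Rmat z1 z2 (a.val + 1) b.val b.val := by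
  apply Matrix.ext
  rintro ⟨α, β⟩ ⟨γ, δ⟩
  rw [Rmat_mul, mul_Rmat]
  simp only [monoQ_eq]
  refine absYBE (Sum.inl a) (Sum.inr b) (by simp) (tP r) z1 z2 (z1 * z2)
    (fun x => match x with | Sum.inl _ => 1 | Sum.inr _ => if a.val = 0 then z1 else 1)
    (fun x => match x with | Sum.inl _ => 1 | Sum.inr _ => if a.val = 0 then z2 else 1)
    (fun x => match x with
      | Sum.inl e => if e < a then tP r else 1 | Sum.inr e => if e < b then tP r else 1)
    (fun n x => (match x with
      | Sum.inl e => if e < a then tP r else 1 | Sum.inr e => if e < b then tP r else 1) ^ n)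
    _ _ _ _ _ ?_ ?_ ?_ ?_ ?_ ?_ ?_ ?_ ?_ ?_ ?_ ?_ ?_ ?_ ?_ ?_ ?_ ?_ ?_ ?_ ?_ ?_ ?_ ?_ ?_
    B n n'' hB α β γ δ
  · intro n; simp [passWeight]
  · intro n; simp [passWeight]
  · intro n; simp [passWeight]
  · intro n; simp [passWeight]
  · rintro n (e | e) h1 h2
    · have : e ≠ a := by simpa using h1
      simp only [passWeight, this, if_false]; split_ifs <;> simp
    · have : e ≠ b := by simpa using h2
      simp only [passWeight, this, if_false]; split_ifs <;> simp
  · rintro n (e | e) h1 h2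
    · have : e ≠ a := by simpa using h1
      simp only [passWeight, this, if_false]; split_ifs <;> simp
    · have : e ≠ b := by simpa using h2
      simp only [passWeight, this, if_false]; split_ifs <;> simp
  · intro n x _ _; rw [pow_succ']
  · rintro (x | x) <;> simp [rhoR]
  · rintro (x | x) <;> simp [rhoR]
  · rintro (x | x) <;> simp [offR]
  · simp [rhoR]
  · simp [rhoR]
  · simp [rhoR]
  · simp [rhoR]
  · simp [offR]
  · simp [offR]
  · rintro (x | x) (y | y) h1 h2 h3 h4 h5 <;> 
    simp only [ne_eq, Sum.inl.injEq, Sum.inr.injEq, Fin.ext_iff] at h1 h2 h3 h4 h5 <;>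
    simp only [rhoR, rk, Fin.ext_iff] <;> split_ifs <;> first | (exfalso; omega) | ring1
  all_goals
    rintro (x | x) h1 h2 <;>
    simp only [ne_eq, Sum.inl.injEq, Sum.inr.injEq, Fin.ext_iff] at h1 h2 <;>
    simp only [rhoR, offR, rk, Fin.ext_iff, Fin.lt_def] <;> split_ifs <;> first | (exfalso; omega) | ring1

end ConcreteYBE


section OrderedProducts

open Matrix Kronecker

/-- Ordered product `A 0 * A 1 * ⋯ * A (n-1)`. -/
def ordProd {M : Type*} [Monoid M] : (n : ℕ) → (Fin n → M) → M
  | 0, _ => 1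
  | n + 1, A => ordProd n (fun i => A i.castSucc) * A (Fin.last n)

theorem ordProd_train {M : Type*} [Monoid M] (R : ℕ → M) (n : ℕ) (A B : Fin n → M)
    (h : ∀ k : Fin n, R k.val * A k = B k * R (k.val + 1)) :
    R 0 * ordProd n A = ordProd n B * R n := by
  induction n with
  | zero => simp [ordProd]
  | succ n ih =>
    have h1 := ih (fun i => A i.castSucc) (fun i => B i.castSucc) (fun k => h k.castSucc)
    have h2 := h (Fin.last n)
    simp only [Fin.val_last] at h2
    simp only [ordProd]
    rw [← mul_assoc, h1, mul_assoc, h2, mul_assoc]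

theorem ordProd_sum {M X : Type*} [Ring M] [DecidableEq X] (n : ℕ) (S : Finset X)
    (g : Fin n → X → M) :
    ∑ f ∈ Fintype.piFinset (fun _ : Fin n => S), ordProd n (fun i => g i (f i))
      = ordProd n (fun i => ∑ x ∈ S, g i x) := by
  induction n with
  | zero => simp [ordProd]
  | succ n ih =>
    simp only [ordProd]
    rw [← ih (fun i => g i.castSucc), Finset.sum_mul_sum, ← Finset.sum_product']
    refine Finset.sum_nbij' (fun f => (fun i : Fin n => f i.castSucc, f (Fin.last n)))
      (fun p => Fin.snoc (α := fun _ => X) p.1 p.2) ?_ ?_ ?_ ?_ ?_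
    · intro f hf
      simp only [Fintype.mem_piFinset] at hf
      simp [hf]
    · rintro ⟨p, x⟩ hp
      simp only [Finset.mem_product, Fintype.mem_piFinset] at hp
      simp only [Fintype.mem_piFinset]
      intro i
      refine Fin.lastCases ?_ ?_ i
      · simpa using hp.2
      · intro j; simpa using hp.1 j
    · intro f _
      funext i
      refine Fin.lastCases ?_ ?_ i <;> simp
    · rintro ⟨p, x⟩ _
      simp
    · intro f _; rfl

theorem ordProd_kron {K ι κ : Type*} [CommRing K] [Fintype ι] [DecidableEq ι]
    [Fintype κ] [DecidableEq κ] (n : ℕ)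
    (A : Fin n → Matrix ι ι K) (B : Fin n → Matrix κ κ K) :
    ordProd n A ⊗ₖ ordProd n B = ordProd n (fun i => A i ⊗ₖ B i) := by
  induction n with
  | zero => simp [ordProd]
  | succ n ih => simp only [ordProd]; rw [Matrix.mul_kronecker_mul, ih]

theorem ordProd_apply {K ι : Type*} [CommRing K] [Fintype ι] [DecidableEq ι] (n : ℕ)
    (A : Fin n → Matrix ι ι K) (l q : ι) :
    ordProd n A l q = ∑ h : Fin (n + 1) → ι, if h 0 = l ∧ h (Fin.last n) = q then
      ∏ j : Fin n, A j (h j.castSucc) (h j.succ) else 0 := by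
  induction n generalizing q with
  | zero =>
    simp only [ordProd, Matrix.one_apply, Finset.univ_eq_empty, Finset.prod_empty]
    rw [Fintype.sum_equiv (Equiv.funUnique (Fin 1) ι) _
      (fun x => if x = l ∧ x = q then (1 : K) else 0)]
    · by_cases h : l = q
      · subst h; simp
      · rw [if_neg h, Finset.sum_eq_zero]
        intro x _; apply if_neg; rintro ⟨rfl, h2⟩; exact h h2
    · intro x; simp [Equiv.funUnique]
  | succ n ih =>
    simp only [ordProd, Matrix.mul_apply]
    rw [← Fintype.sum_equiv (Fin.snocEquiv (fun _ : Fin (n + 2) => ι))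
      (fun p : ι × (Fin (n + 1) → ι) => if p.2 0 = l ∧ p.1 = q then
        (∏ j : Fin n, A j.castSucc (p.2 j.castSucc) (p.2 j.succ)) *
          A (Fin.last n) (p.2 (Fin.last n)) p.1 else 0)]
    · rw [Fintype.sum_prod_type]
      refine Eq.symm ((Finset.sum_eq_single q ?_ ?_).trans ?_)
      · intro b _ hb; simp [hb]
      · simp
      · simp only [and_true]
        simp only [ih, Finset.sum_mul]
        rw [Finset.sum_comm]
        refine Finset.sum_congr rfl fun h _ => ?_
        rw [Finset.sum_eq_single (h (Fin.last n))]
        · by_cases h0 : h 0 = l <;> simp [h0]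
        · intro b _ hb; simp [hb.symm]
        · simp
    · rintro ⟨x, p⟩
      have h0 : (Fin.snocEquiv (fun _ : Fin (n + 2) => ι)) (x, p) 0 = p 0 := by
        change Fin.snoc (α := fun _ => ι) p x (Fin.castSucc 0) = _
        simp
      have hl : (Fin.snocEquiv (fun _ : Fin (n + 2) => ι)) (x, p) (Fin.last (n + 1)) = x := by
        change Fin.snoc (α := fun _ => ι) p x (Fin.last _) = _
        simp
      have hc : ∀ j : Fin (n + 1),
          (Fin.snocEquiv (fun _ : Fin (n + 2) => ι)) (x, p) j.castSucc = p j := by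
        intro j
        change Fin.snoc (α := fun _ => ι) p x (Fin.castSucc j) = _
        simp
      rw [h0, hl, Fin.prod_univ_castSucc]
      simp only [hc, Fin.succ_last, hl, Fin.succ_castSucc]

theorem sum_piFinset_reindex {α β X M : Type*} [Fintype α] [Fintype β] [DecidableEq α]
    [DecidableEq β] [AddCommMonoid M] (e : α ≃ β) (S : Finset X) (F : (α → X) → M) :
    ∑ f ∈ Fintype.piFinset (fun _ : β => S), F (fun a => f (e a))
      = ∑ g ∈ Fintype.piFinset (fun _ : α => S), F g := by
  refine Finset.sum_nbij' (fun f a => f (e a)) (fun g b => g (e.symm b)) ?_ ?_ ?_ ?_ ?_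
  · intro f hf; simp only [Fintype.mem_piFinset] at hf ⊢; intro a; exact hf _
  · intro f hf; simp only [Fintype.mem_piFinset] at hf ⊢; intro a; exact hf _
  · intro f _; funext b; simp
  · intro f _; funext b; simp
  · intro f _; rfl

end OrderedProducts

section Columns

open Matrix Kronecker

/-- The enumeration of bosons as an equivalence. -/
noncomputable def bosonEquiv (r : ℕ) : Fin (r * r) ≃ Fin r × Fin r :=
  Equiv.ofBijective bosonOfIdx (by
    rw [Fintype.bijective_iff_injective_and_card]
    refine ⟨?_, by simp⟩
    intro k l h
    have hr : 0 < r := by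
      rcases Nat.eq_zero_or_pos r with h | h
      · exact absurd k.2 (by simp [h])
      · exact h
    simp only [bosonOfIdx, Prod.mk.injEq, Fin.mk.injEq] at h
    obtain ⟨h1, h2⟩ := h
    have hk : k.val / r < r := Nat.div_lt_of_lt_mul k.2
    have hl : l.val / r < r := Nat.div_lt_of_lt_mul l.2
    have h3 : k.val / r = l.val / r := by omega
    apply Fin.ext
    rw [← Nat.div_add_mod k.val r, ← Nat.div_add_mod l.val r, h1, h3])

/-- Vertex weight matrix. -/
noncomputable def vertM {r : ℕ} (z : PolyR r) (m m' : Fin r × Fin r → ℕ) :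
    Matrix (Spin r) (Spin r) (PolyR r) :=
  ordProd (r * r) (fun k => monoM z (bosonOfIdx k) (m (bosonOfIdx k)) (m' (bosonOfIdx k)))

theorem step_next {r : ℕ} (m m' : Fin r × Fin r → ℕ) (ab : Fin r × Fin r) (x y : Spin r)
    (h : StepOK m m' ab x y) : y = nextSpin m m' ab x := by
  unfold nextSpin
  rcases h with ⟨h1, h2⟩ | ⟨h1, h2, h3⟩ | ⟨h1, h2, h3⟩
  · rw [if_neg (by omega), if_neg (by omega), h1]
  · rw [if_pos h3, h2]
  · rw [if_neg (by omega), if_pos h3, h2]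

theorem path_unique {r : ℕ} (m m' : Fin r × Fin r → ℕ) (l : Spin r)
    (x : Fin (r * r + 1) → Spin r) (h0 : x 0 = l)
    (h : ∀ k : Fin (r * r), StepOK m m' (bosonOfIdx k) (x k.castSucc) (x k.succ)) :
    ∀ k : Fin (r * r + 1), x k = pathSpin m m' l k.val := by
  intro k
  induction k using Fin.induction with
  | zero => simp [pathSpin, h0]
  | succ k ih =>
    rw [step_next m m' _ _ _ (h k), ih]
    simp [pathSpin]

theorem vertM_apply {r : ℕ} (z : PolyR r) (m m' : Fin r × Fin r → ℕ) (l q : Spin r) :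
    vertM z m m' l q = Wvert z l m q m' := by
  classical
  unfold vertM Wvert
  rw [ordProd_apply]
  have key : ∀ x : Fin (r * r + 1) → Spin r,
      (∏ k : Fin (r * r), monoM z (bosonOfIdx k) (m (bosonOfIdx k)) (m' (bosonOfIdx k))
        (x k.castSucc) (x k.succ)) =
      if ∀ k : Fin (r * r), StepOK m m' (bosonOfIdx k) (x k.castSucc) (x k.succ) then
        ∏ k : Fin (r * r), stepWeight z (m (bosonOfIdx k)) (m' (bosonOfIdx k)) (bosonOfIdx k)
          (x k.castSucc) else 0 := by
    intro x
    split_ifs with h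
    · refine Finset.prod_congr rfl fun k _ => ?_
      exact if_pos (h k)
    · push Not at h
      obtain ⟨k, hk⟩ := h
      exact Finset.prod_eq_zero (Finset.mem_univ k) (if_neg hk)
  simp only [key]
  split_ifs with hA
  · obtain ⟨x, h0, h1, h2⟩ := hA
    have hu := path_unique m m' l x h0 h2
    rw [Finset.sum_eq_single x]
    · rw [if_pos ⟨h0, h1⟩, if_pos h2]
      unfold vertexWeight
      refine Finset.prod_congr rfl fun k _ => ?_
      rw [hu]; rfl
    · intro y _ hy
      split_ifs with h3 h4
      · exact absurd (funext fun k => by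
          rw [hu k, path_unique m m' l y h3.1 h4 k]) hy
      · rfl
      · rfl
    · simp
  · apply Finset.sum_eq_zero
    intro x _
    split_ifs with h3 h4
    · exact absurd ⟨x, h3.1, h3.2, h4⟩ hA
    · rfl
    · rfl

/-- The R-matrix before the `k`-th boson. -/
noncomputable def Rseq {r : ℕ} (z1 z2 : PolyR r) (k : ℕ) :
    Matrix (Spin r × Spin r) (Spin r × Spin r) (PolyR r) :=
  Rmat z1 z2 (k % r) (if k % r = 0 then r - k / r else r - 1 - k / r) (r - 1 - k / r)

theorem Rmat_congr {r : ℕ} (z1 z2 : PolyR r) (u β b u' β' b' : ℕ)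
    (h : ∀ x y, rhoR z1 z2 u β b x y = rhoR z1 z2 u' β' b' x y) :
    Rmat z1 z2 u β b = Rmat z1 z2 u' β' b' := by
  unfold Rmat
  funext p q
  rw [h]

theorem Rmat_wrap {r : ℕ} (z1 z2 : PolyR r) (β b b' : ℕ) :
    Rmat z1 z2 r β b = Rmat z1 z2 0 β b' := by
  apply Rmat_congr
  rintro (x | x) (y | y) <;> have hx := x.2 <;> have hy := y.2 <;>
    simp only [rhoR, rk, Fin.ext_iff] <;> split_ifs <;> first | rfl | (exfalso; omega)

theorem Rmat_wrap' {r : ℕ} (z1 z2 : PolyR r) (b b' : ℕ) :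
    Rmat z1 z2 0 r b = Rmat z1 z2 0 0 b' := by
  apply Rmat_congr
  rintro (x | x) (y | y) <;> have hx := x.2 <;> have hy := y.2 <;>
    simp only [rhoR, rk, Fin.ext_iff] <;> split_ifs <;> first | rfl | (exfalso; omega)

theorem Rseq_step {r : ℕ} (z1 z2 : PolyR r) (B : ℕ) (m m'' : Fin r × Fin r → ℕ)
    (hB : ∀ ab, m ab + 2 ≤ B) (k : Fin (r * r)) :
    Rseq z1 z2 k.val * monoQ z1 z2 (bosonOfIdx k) B (m (bosonOfIdx k)) (m'' (bosonOfIdx k))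
      = monoQ z2 z1 (bosonOfIdx k) B (m (bosonOfIdx k)) (m'' (bosonOfIdx k))
        * Rseq z1 z2 (k.val + 1) := by
  have hr : 0 < r := by
    rcases Nat.eq_zero_or_pos r with h | h
    · exact absurd k.2 (by simp [h])
    · exact h
  have hk : k.val / r < r := Nat.div_lt_of_lt_mul k.2
  have hm : k.val % r < r := Nat.mod_lt _ hr
  have h := monoYBE z1 z2 (bosonOfIdx k).1 (bosonOfIdx k).2 B (m (bosonOfIdx k))
    (m'' (bosonOfIdx k)) (hB _)
  have e1 : Rmat z1 z2 (bosonOfIdx k).1.val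
      (if (bosonOfIdx k).1.val = 0 then (bosonOfIdx k).2.val + 1 else (bosonOfIdx k).2.val)
      (bosonOfIdx k).2.val = Rseq z1 z2 k.val := by
    have f1 : (bosonOfIdx k).1.val = k.val % r := rfl
    have f2 : (bosonOfIdx k).2.val = r - 1 - k.val / r := rfl
    rw [f1, f2]
    unfold Rseq
    by_cases hc : k.val % r = 0
    · rw [if_pos hc, if_pos hc]
      congr 1
      omega
    · rw [if_neg hc, if_neg hc]
  have e2 : Rmat z1 z2 ((bosonOfIdx k).1.val + 1) (bosonOfIdx k).2.val (bosonOfIdx k).2.val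
      = Rseq z1 z2 (k.val + 1) := by
    simp only [bosonOfIdx, Rseq]
    by_cases hc : k.val % r + 1 = r
    · have d0 : k.val + 1 = r * (k.val / r + 1) := by
        have := Nat.div_add_mod k.val r
        rw [Nat.mul_add]
        omega
      have d1 : (k.val + 1) / r = k.val / r + 1 := by
        conv_lhs => rw [d0]
        exact Nat.mul_div_cancel_left _ hr
      have d2 : (k.val + 1) % r = 0 := by
        conv_lhs => rw [d0]
        exact Nat.mul_mod_right _ _
      rw [d1, d2, hc, if_pos rfl]
      rw [Rmat_wrap z1 z2 _ _ (r - 1 - (k.val / r + 1))]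
      congr 1
      omega
    · have d0 : k.val + 1 = r * (k.val / r) + (k.val % r + 1) := by
        have := Nat.div_add_mod k.val r
        omega
      have d3 : k.val % r + 1 < r := by omega
      have d1 : (k.val + 1) / r = k.val / r := by
        conv_lhs => rw [d0]
        rw [Nat.mul_add_div hr, Nat.div_eq_of_lt d3, Nat.add_zero]
      have d2 : (k.val + 1) % r = k.val % r + 1 := by
        conv_lhs => rw [d0]
        rw [Nat.mul_add_mod, Nat.mod_eq_of_lt d3]
      rw [d1, d2, if_neg (by omega)]
  rw [e1, e2] at h
  exact h

/-- The set of bounded one-column configurations. -/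
def colS (r B : ℕ) : Finset (Fin r × Fin r → ℕ) :=
  Fintype.piFinset (fun _ : Fin r × Fin r => Finset.range B)

/-- Two stacked vertices. -/
noncomputable def colQ {r : ℕ} (z1 z2 : PolyR r) (B : ℕ) (m m'' : Fin r × Fin r → ℕ) :
    Matrix (Spin r × Spin r) (Spin r × Spin r) (PolyR r) :=
  ∑ m' ∈ colS r B, vertM z1 m m' ⊗ₖ vertM z2 m' m''

theorem colQ_eq {r : ℕ} (z1 z2 : PolyR r) (B : ℕ) (m m'' : Fin r × Fin r → ℕ) :
    colQ z1 z2 B m m'' = ordProd (r * r) (fun k =>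
      monoQ z1 z2 (bosonOfIdx k) B (m (bosonOfIdx k)) (m'' (bosonOfIdx k))) := by
  unfold colQ colS monoQ
  rw [← ordProd_sum, ← sum_piFinset_reindex (bosonEquiv r)]
  refine Finset.sum_congr rfl fun m' _ => ?_
  unfold vertM
  rw [ordProd_kron]
  rfl

theorem colYBE {r : ℕ} (hr : 0 < r) (z1 z2 : PolyR r) (B : ℕ) (m m'' : Fin r × Fin r → ℕ)
    (hB : ∀ ab, m ab + 2 ≤ B) :
    Rmat z1 z2 0 0 0 * colQ z1 z2 B m m'' = colQ z2 z1 B m m'' * Rmat z1 z2 0 0 0 := by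
  have h := ordProd_train (Rseq z1 z2) (r * r) _ _ (Rseq_step z1 z2 B m m'' hB)
  rw [← colQ_eq, ← colQ_eq] at h
  have e1 : Rseq z1 z2 0 = Rmat z1 z2 0 0 0 := by
    simp only [Rseq, Nat.zero_mod, Nat.zero_div, if_true, Nat.sub_zero]
    exact Rmat_wrap' z1 z2 _ _
  have e2 : Rseq z1 z2 (r * r) = Rmat z1 z2 0 0 0 := by
    simp only [Rseq, Nat.mul_mod_left, if_true, Nat.mul_div_cancel _ hr, Nat.sub_self]
    congr 1; omega
  rw [e1, e2] at h
  exact h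

/-- Row weight matrix. -/
noncomputable def rowM {r N : ℕ} (z : PolyR r) (m m' : Fin N → Fin r × Fin r → ℕ) :
    Matrix (Spin r) (Spin r) (PolyR r) :=
  ordProd N (fun j => vertM z (m j.rev) (m' j.rev))

theorem rowM_apply {r N : ℕ} (z : PolyR r) (m m' : Fin N → Fin r × Fin r → ℕ) (l q : Spin r) :
    rowM z m m' l q = ∑ h : Fin (N + 1) → Spin r, if h 0 = q ∧ h (Fin.last N) = l then
      ∏ j : Fin N, Wvert z (h j.succ) (m j) (h j.castSucc) (m' j) else 0 := by
  unfold rowM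
  rw [ordProd_apply]
  refine Fintype.sum_equiv (Equiv.arrowCongr Fin.revPerm (Equiv.refl _)) _ _ ?_
  intro h
  have e : ∀ k, (Equiv.arrowCongr Fin.revPerm (Equiv.refl (Spin r))) h k = h k.rev := by
    intro k; simp [Equiv.arrowCongr]
  simp only [e, Fin.rev_zero, Fin.rev_last]
  refine if_congr and_comm ?_ rfl
  rw [← Equiv.prod_comp Fin.revPerm]
  refine Finset.prod_congr rfl fun j _ => ?_
  simp [vertM_apply, Fin.rev_succ, Fin.rev_castSucc]

/-- Bounded row configurations. -/
def rowS (r N B : ℕ) : Finset (Fin N → Fin r × Fin r → ℕ) :=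
  Fintype.piFinset (fun _ : Fin N => colS r B)

theorem rowYBE {r N : ℕ} (hr : 0 < r) (z1 z2 : PolyR r) (B : ℕ)
    (m m'' : Fin N → Fin r × Fin r → ℕ) (hB : ∀ j ab, m j ab + 2 ≤ B) :
    Rmat z1 z2 0 0 0 * (∑ m' ∈ rowS r N B, rowM z1 m m' ⊗ₖ rowM z2 m' m'')
      = (∑ m' ∈ rowS r N B, rowM z2 m m' ⊗ₖ rowM z1 m' m'') * Rmat z1 z2 0 0 0 := by
  have key : ∀ y1 y2 : PolyR r, ∑ m' ∈ rowS r N B, rowM y1 m m' ⊗ₖ rowM y2 m' m''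
      = ordProd N (fun j => colQ y1 y2 B (m j.rev) (m'' j.rev)) := by
    intro y1 y2
    unfold rowS colQ
    rw [← ordProd_sum, ← sum_piFinset_reindex Fin.revPerm]
    refine Finset.sum_congr rfl fun m' _ => ?_
    unfold rowM
    rw [ordProd_kron]
    simp only [Fin.revPerm_apply, Fin.rev_rev]
  rw [key, key]
  exact ordProd_train (fun _ => Rmat z1 z2 0 0 0) N _ _
    (fun k => colYBE hr z1 z2 B _ _ (fun ab => hB _ ab))

end Columns

section Partition

open Matrix Kronecker

theorem sum_pi_zero {ι X M : Type*} [Fintype ι] [DecidableEq ι] [DecidableEq X]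
    [AddCommMonoid M] (S : ι → Finset X) (k : ι) (F : (ι → X) → M)
    (h : ∀ m ∈ Fintype.piFinset S, ∑ v ∈ S k, F (Function.update m k v) = 0) :
    ∑ m ∈ Fintype.piFinset S, F m = 0 := by
  classical
  by_cases hne : (Fintype.piFinset S).Nonempty
  swap
  · rw [Finset.not_nonempty_iff_eq_empty] at hne
    rw [hne, Finset.sum_empty]
  obtain ⟨x0, hx0⟩ := hne
  rw [← Finset.sum_fiberwise_of_maps_to (s := Fintype.piFinset S)
    (t := (Fintype.piFinset S).image (fun m => Function.update m k (x0 k)))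
    (g := fun m => Function.update m k (x0 k))
    (fun x hx => Finset.mem_image_of_mem _ hx)]
  refine Finset.sum_eq_zero fun y hy => ?_
  obtain ⟨m0, hm0, rfl⟩ := Finset.mem_image.mp hy
  rw [← h m0 hm0]
  refine Finset.sum_nbij' (fun m => m k) (fun v => Function.update m0 k v) ?_ ?_ ?_ ?_ ?_
  · intro m hm
    exact Fintype.mem_piFinset.mp (Finset.mem_filter.mp hm).1 k
  · intro v hv
    refine Finset.mem_filter.mpr ⟨Fintype.mem_piFinset.mpr fun i => ?_, by simp⟩
    by_cases hi : i = k
    · subst hi; simpa using hv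
    · simpa [hi] using Fintype.mem_piFinset.mp hm0 i
  · intro m hm
    have h2 := (Finset.mem_filter.mp hm).2
    funext i
    by_cases hi : i = k
    · subst hi; simp
    · have := congrFun h2 i
      simp only [Function.update_of_ne hi] at this
      simp [hi, this]
  · intro v _; simp
  · intro m hm
    have h2 := (Finset.mem_filter.mp hm).2
    congr 1
    funext i
    by_cases hi : i = k
    · subst hi; simp
    · have := congrFun h2 i
      simp only [Function.update_of_ne hi] at this
      simp [hi, this]

/-- Weight of all rows for fixed vertical data. -/
noncomputable def rowsT {r N : ℕ} (top : Fin N → Fin r × Fin r → ℕ) (ζ : Fin r → PolyR r)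
    (l ρ : Fin r → Spin r) (m : Fin (r + 1) → Fin N → Fin r × Fin r → ℕ) : PolyR r :=
  if m 0 = top ∧ m (Fin.last r) = 0 then
    ∏ i : Fin r, rowM (ζ i) (m i.castSucc) (m i.succ) (l i) (ρ i) else 0

/-- Bounded vertical data. -/
def allS (r N : ℕ) : Finset (Fin (r + 1) → Fin N → Fin r × Fin r → ℕ) :=
  Fintype.piFinset (fun i : Fin (r + 1) => rowS r N (r + 2 * i.val + 1))

/-- Partition function with general row parameters. -/
noncomputable def Zgen {r N : ℕ} (top : Fin N → Fin r × Fin r → ℕ) (ζ : Fin r → PolyR r)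
    (l ρ : Fin r → Spin r) : PolyR r :=
  ∑ m ∈ allS r N, rowsT top ζ l ρ m

theorem rowsT_update {r N : ℕ} (top : Fin N → Fin r × Fin r → ℕ) (ζ : Fin r → PolyR r)
    (l ρ : Fin r → Spin r) (m : Fin (r + 1) → Fin N → Fin r × Fin r → ℕ) (a b : Fin r)
    (hab : b.val = a.val + 1) (v : Fin N → Fin r × Fin r → ℕ) :
    rowsT top ζ l ρ (Function.update m a.succ v) =
      (if m 0 = top ∧ m (Fin.last r) = 0 then
        ∏ i ∈ Finset.univ \ {a, b}, rowM (ζ i) (m i.castSucc) (m i.succ) (l i) (ρ i) else 0) *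
      (rowM (ζ a) (m a.castSucc) v (l a) (ρ a) * rowM (ζ b) v (m b.succ) (l b) (ρ b)) := by
  have hne : a ≠ b := by intro h; rw [h] at hab; omega
  have hb := b.2
  have hk : b.castSucc = a.succ := by ext; simp [hab]
  have h0 : (0 : Fin (r + 1)) ≠ a.succ := (Fin.succ_ne_zero a).symm
  have hl : Fin.last r ≠ a.succ := by
    intro h; have := congrArg Fin.val h; simp at this; omega
  unfold rowsT
  rw [Function.update_of_ne h0, Function.update_of_ne hl]
  split_ifs with hc
  · rw [← Finset.prod_sdiff (Finset.subset_univ {a, b}), Finset.prod_pair hne]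
    congr 1
    · refine Finset.prod_congr rfl fun i hi => ?_
      simp only [Finset.mem_sdiff, Finset.mem_univ, true_and, Finset.mem_insert,
        Finset.mem_singleton, not_or] at hi
      have h1 : i.succ ≠ a.succ := fun h => hi.1 (Fin.succ_injective _ h)
      have h2 : i.castSucc ≠ a.succ := by
        rw [← hk]; exact fun h => hi.2 (Fin.castSucc_injective _ h)
      rw [Function.update_of_ne h1, Function.update_of_ne h2]
    · have h1 : a.castSucc ≠ a.succ := by
        intro h; have := congrArg Fin.val h; simp at this
      have h2 : b.succ ≠ a.succ := fun h => hne (Fin.succ_injective _ h).symm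
      rw [hk, Function.update_self, Function.update_of_ne h1, Function.update_of_ne h2]
  · simp

theorem rowYBE_entry {r N : ℕ} (hr : 0 < r) (z1 z2 : PolyR r) (B : ℕ)
    (m m'' : Fin N → Fin r × Fin r → ℕ) (hB : ∀ j ab, m j ab + 2 ≤ B) (x1 x2 y1 y2 : Spin r) :
    rhoR z1 z2 0 0 0 x1 x2 * (∑ v ∈ rowS r N B, rowM z1 m v x1 y1 * rowM z2 v m'' x2 y2)
      + offR z1 z2 x1 x2 * (∑ v ∈ rowS r N B, rowM z1 m v x2 y1 * rowM z2 v m'' x1 y2)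
    = rhoR z1 z2 0 0 0 y1 y2 * (∑ v ∈ rowS r N B, rowM z2 m v x1 y1 * rowM z1 v m'' x2 y2)
      + offR z1 z2 y2 y1 * (∑ v ∈ rowS r N B, rowM z2 m v x1 y2 * rowM z1 v m'' x2 y1) := by
  have h := congrFun (congrFun (rowYBE hr z1 z2 B m m'' hB) (x1, x2)) (y1, y2)
  rw [Rmat_mul, mul_Rmat] at h
  simpa only [Matrix.sum_apply, Matrix.kroneckerMap_apply] using h

theorem Zgen_YBE {r N : ℕ} (top : Fin N → Fin r × Fin r → ℕ) (ζ : Fin r → PolyR r)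
    (l ρ : Fin r → Spin r) (a b : Fin r) (hab : b.val = a.val + 1) :
    rhoR (ζ a) (ζ b) 0 0 0 (l a) (l b) * Zgen top ζ l ρ
      + offR (ζ a) (ζ b) (l a) (l b) * Zgen top ζ (l ∘ Equiv.swap a b) ρ
    = rhoR (ζ a) (ζ b) 0 0 0 (ρ a) (ρ b) * Zgen top (ζ ∘ Equiv.swap a b) l ρ
      + offR (ζ a) (ζ b) (ρ b) (ρ a)
        * Zgen top (ζ ∘ Equiv.swap a b) l (ρ ∘ Equiv.swap a b) := by
  have hr : 0 < r := a.pos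
  rw [← sub_eq_zero]
  unfold Zgen
  simp only [Finset.mul_sum]
  rw [← Finset.sum_add_distrib, ← Finset.sum_add_distrib, ← Finset.sum_sub_distrib]
  unfold allS
  refine sum_pi_zero _ a.succ _ ?_
  intro m hm
  have hB : ∀ j ab, m a.castSucc j ab + 2 ≤ r + 2 * a.succ.val + 1 := by
    intro j ab
    have h1 := Fintype.mem_piFinset.mp hm a.castSucc
    have h2 := Fintype.mem_piFinset.mp (Fintype.mem_piFinset.mp h1 j) ab
    simp only [Finset.mem_range, Fin.val_castSucc] at h2
    simp only [Fin.val_succ]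
    omega
  have hE := rowYBE_entry hr (ζ a) (ζ b) _ (m a.castSucc) (m b.succ) hB (l a) (l b) (ρ a) (ρ b)
  simp only [rowsT_update _ _ _ _ _ a b hab]
  have hsw : ∀ i ∈ Finset.univ \ {a, b}, Equiv.swap a b i = i := by
    intro i hi
    simp only [Finset.mem_sdiff, Finset.mem_univ, true_and, Finset.mem_insert,
        Finset.mem_singleton, not_or] at hi
    exact Equiv.swap_apply_of_ne_of_ne hi.1 hi.2
  have hp : ∀ (ζ' : Fin r → PolyR r) (l' ρ' : Fin r → Spin r),
      (∀ i ∈ Finset.univ \ {a, b}, ζ' i = ζ i ∧ l' i = l i ∧ ρ' i = ρ i) →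
      (if m 0 = top ∧ m (Fin.last r) = 0 then
        ∏ i ∈ Finset.univ \ {a, b}, rowM (ζ' i) (m i.castSucc) (m i.succ) (l' i) (ρ' i) else 0)
      = (if m 0 = top ∧ m (Fin.last r) = 0 then
        ∏ i ∈ Finset.univ \ {a, b}, rowM (ζ i) (m i.castSucc) (m i.succ) (l i) (ρ i) else 0) := by
    intro ζ' l' ρ' h
    refine if_congr Iff.rfl (Finset.prod_congr rfl fun i hi => ?_) rfl
    rw [(h i hi).1, (h i hi).2.1, (h i hi).2.2]
  rw [hp ζ (l ∘ Equiv.swap a b) ρ (fun i hi => ⟨rfl, by simp [hsw i hi], rfl⟩),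
    hp (ζ ∘ Equiv.swap a b) l ρ (fun i hi => ⟨by simp [hsw i hi], rfl, rfl⟩),
    hp (ζ ∘ Equiv.swap a b) l (ρ ∘ Equiv.swap a b)
      (fun i hi => ⟨by simp [hsw i hi], rfl, by simp [hsw i hi]⟩)]
  simp only [Function.comp_apply, Equiv.swap_apply_left, Equiv.swap_apply_right]
  generalize (if m 0 = top ∧ m (Fin.last r) = 0 then
        ∏ i ∈ Finset.univ \ {a, b}, rowM (ζ i) (m i.castSucc) (m i.succ) (l i) (ρ i) else 0) = P
  rw [← sub_eq_zero] at hE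
  have hE2 := congrArg (fun x => P * x) hE
  simp only [mul_zero] at hE2
  rw [← hE2]
  simp only [Finset.mul_sum]
  rw [← Finset.sum_add_distrib, ← Finset.sum_add_distrib, ← Finset.sum_sub_distrib,
    Finset.mul_sum]
  refine Finset.sum_congr rfl fun v _ => ?_
  ring

/-- Fillings as pairs. -/
def fillEquiv (r N : ℕ) : ((Fin (r + 1) → Fin N → Fin r × Fin r → ℕ) ×
    (Fin r → Fin (N + 1) → Spin r)) ≃ Filling r N where
  toFun p := ⟨p.1, p.2⟩
  invFun f := (f.m, f.h)
  left_inv _ := rfl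
  right_inv _ := rfl

/-- Top boundary data. -/
def topM {r : ℕ} (N : ℕ) (lam : Fin r → ℕ) (w3 w4 : Equiv.Perm (Fin r)) :
    Fin N → Fin r × Fin r → ℕ := fun j ab =>
  (Finset.univ.filter fun i : Fin r =>
            lam i = j.val ∧ w3⁻¹ i = ab.1 ∧ w4⁻¹ (Fin.rev i) = ab.2).card

theorem adm_le {r : ℕ} (l : Spin r) (m : Fin r × Fin r → ℕ) (rr : Spin r)
    (m' : Fin r × Fin r → ℕ) (h : AdmissibleVertex l m rr m') (ab : Fin r × Fin r) :
    m' ab ≤ m ab + 1 := by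
  obtain ⟨x, _, _, hx⟩ := h
  have h1 : bosonOfIdx ((bosonEquiv r).symm ab) = ab := (bosonEquiv r).apply_symm_apply ab
  have h2 := hx ((bosonEquiv r).symm ab)
  rw [h1] at h2
  rcases h2 with h | h | h
  · omega
  · omega
  · omega

theorem inSystem_mem {r N : ℕ} (lam : Fin r → ℕ) (w1 w2 w3 w4 : Equiv.Perm (Fin r))
    (f : Filling r N) (hf : InSystem lam w1 w2 w3 w4 f) : f.m ∈ allS r N := by
  obtain ⟨h1, h2, -⟩ := hf
  have key : ∀ (i : Fin (r + 1)) (j : Fin N) (ab : Fin r × Fin r), f.m i j ab ≤ r + i.val := by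
    intro i
    induction i using Fin.induction with
    | zero =>
      rintro j ⟨a, b⟩
      rw [h2]
      refine (Finset.card_le_univ _).trans ?_
      simp
    | succ i ih =>
      intro j ab
      have h3 := adm_le _ _ _ _ (h1 i j) ab
      have h4 := ih j ab
      simp only [Fin.val_castSucc] at h4
      simp only [Fin.val_succ]
      omega
  unfold allS rowS colS
  simp only [Fintype.mem_piFinset, Finset.mem_range]
  intro i j ab
  have := key i j ab
  omega

theorem partitionZ_eq (r N : ℕ) (lam : Fin r → ℕ) (w1 w2 w3 w4 : Equiv.Perm (Fin r)) :
    partitionZ r N lam w1 w2 w3 w4 =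
      Zgen (topM N lam w3 w4) zP (fun i => Sum.inr (w2⁻¹ i)) (fun i => Sum.inl (w1⁻¹ i)) := by
  classical
  unfold partitionZ
  rw [← finsum_comp_equiv (fillEquiv r N)]
  rw [finsum_eq_sum_of_support_subset (s := allS r N ×ˢ Finset.univ)]
  · rw [Finset.sum_product]
    unfold Zgen
    refine Finset.sum_congr rfl fun m _ => ?_
    unfold rowsT
    simp only [rowM_apply]
    rw [Finset.prod_univ_sum, Fintype.piFinset_univ]
    by_cases hb : m 0 = topM N lam w3 w4 ∧ m (Fin.last r) = 0
    · rw [if_pos hb]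
      refine Finset.sum_congr rfl fun h _ => ?_
      by_cases hs : InSystem lam w1 w2 w3 w4 (fillEquiv r N (m, h))
      · rw [if_pos hs]
        unfold stateWeight
        refine Finset.prod_congr rfl fun i _ => ?_
        rw [if_pos ⟨hs.2.2.2.1 i, hs.2.2.2.2 i⟩]
        refine Finset.prod_congr rfl fun j _ => ?_
        exact (if_pos (hs.1 i j)).symm
      · rw [if_neg hs]
        symm
        by_contra hne
        rw [← ne_eq, Finset.prod_ne_zero_iff] at hne
        apply hs
        have hI : ∀ i, h i 0 = Sum.inl (w1⁻¹ i) ∧ h i (Fin.last N) = Sum.inr (w2⁻¹ i) := by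
          intro i
          by_contra hc
          exact hne i (Finset.mem_univ _) (if_neg hc)
        refine ⟨?_, ?_, ?_, fun i => (hI i).1, fun i => (hI i).2⟩
        · intro i j
          have h1 := hne i (Finset.mem_univ _)
          rw [if_pos (hI i), Finset.prod_ne_zero_iff] at h1
          by_contra hc
          exact h1 j (Finset.mem_univ _) (if_neg hc)
        · intro j a b
          exact congrFun (congrFun hb.1 j) (a, b)
        · intro j ab
          exact congrFun (congrFun hb.2 j) ab
    · rw [if_neg hb]
      refine Finset.sum_eq_zero fun h _ => ?_
      apply if_neg
      intro hs
      apply hb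
      constructor
      · funext j ab
        exact hs.2.1 j ab.1 ab.2
      · funext j ab
        exact hs.2.2.1 j ab
  · intro p hp
    simp only [Function.mem_support] at hp
    rw [Finset.coe_product]
    refine ⟨?_, by simp⟩
    have hs : InSystem lam w1 w2 w3 w4 (fillEquiv r N p) := by
      by_contra hc
      exact hp (if_neg hc)
    exact inSystem_mem _ _ _ _ _ _ hs

end Partition

section Final

theorem stepWeight_map {r : ℕ} (f : PolyR r →+* PolyR r) (ht : f (tP r) = tP r) (z : PolyR r)
    (m m' : ℕ) (ab : Fin r × Fin r) (x : Spin r) :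
    f (stepWeight z m m' ab x) = stepWeight (f z) m m' ab x := by
  unfold stepWeight passWeight
  rcases x with e | e <;> simp only <;> split_ifs <;> simp [ht]

theorem Wvert_map {r : ℕ} (f : PolyR r →+* PolyR r) (ht : f (tP r) = tP r) (z : PolyR r)
    (l : Spin r) (m : Fin r × Fin r → ℕ) (rr : Spin r) (m' : Fin r × Fin r → ℕ) :
    f (Wvert z l m rr m') = Wvert (f z) l m rr m' := by
  unfold Wvert vertexWeight
  split_ifs
  · rw [map_prod]
    exact Finset.prod_congr rfl fun k _ => stepWeight_map f ht _ _ _ _ _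
  · exact map_zero f

theorem rowM_map {r N : ℕ} (f : PolyR r →+* PolyR r) (ht : f (tP r) = tP r) (z : PolyR r)
    (m m' : Fin N → Fin r × Fin r → ℕ) (l q : Spin r) :
    f (rowM z m m' l q) = rowM (f z) m m' l q := by
  rw [rowM_apply, rowM_apply, map_sum]
  refine Finset.sum_congr rfl fun h _ => ?_
  rw [apply_ite f, map_prod, map_zero]
  simp only [Wvert_map f ht]

theorem Zgen_map {r N : ℕ} (f : PolyR r →+* PolyR r) (ht : f (tP r) = tP r)
    (top : Fin N → Fin r × Fin r → ℕ) (ζ : Fin r → PolyR r) (l ρ : Fin r → Spin r) :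
    f (Zgen top ζ l ρ) = Zgen top (fun i => f (ζ i)) l ρ := by
  unfold Zgen rowsT
  rw [map_sum]
  refine Finset.sum_congr rfl fun m _ => ?_
  rw [apply_ite f, map_prod, map_zero]
  simp only [rowM_map f ht]

theorem toFF_t (r : ℕ) : toFF r (tP r) = tF r := by
  simp [toFF, tP]

theorem toFF_z {r : ℕ} (i : Fin r) : toFF r (zP i) = zF i := by
  simp [toFF, zP]

theorem sigmaF_t {r : ℕ} (a b : Fin r) : sigmaF a b (tF r) = tF r := by
  unfold sigmaF tF
  rw [IsFractionRing.ringEquivOfRingEquiv_algebraMap]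
  simp

theorem sigmaF_z {r : ℕ} (a b i : Fin r) : sigmaF a b (zF i) = zF (Equiv.swap a b i) := by
  unfold sigmaF zF
  rw [IsFractionRing.ringEquivOfRingEquiv_algebraMap]
  simp

/-- The swap on polynomials. -/
noncomputable def swapP {r : ℕ} (a b : Fin r) : PolyR r →+* PolyR r :=
  (MvPolynomial.rename (Option.map (Equiv.swap a b)) :
    PolyR r →ₐ[ℤ] PolyR r).toRingHom

theorem swapP_t {r : ℕ} (a b : Fin r) : swapP a b (tP r) = tP r := by
  simp [swapP, tP]

theorem swapP_z {r : ℕ} (a b i : Fin r) : swapP a b (zP i) = zP (Equiv.swap a b i) := by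
  simp [swapP, zP]

theorem sigmaF_toFF {r : ℕ} (a b : Fin r) (P : PolyR r) :
    sigmaF a b (toFF r P) = toFF r (swapP a b P) := by
  have h : ((sigmaF a b : FFld r ≃+* FFld r) : FFld r →+* FFld r).comp (toFF r)
      = (toFF r).comp (swapP a b) := by
    apply MvPolynomial.ringHom_ext
    · intro n
      simp
    · rintro (_ | i)
      · have h1 := toFF_t r
        have h2 := swapP_t a b
        unfold tP at h1 h2
        simp only [RingHom.comp_apply, RingHom.coe_coe]
        rw [h2, h1, sigmaF_t]
      · have h1 : ∀ i, toFF r (MvPolynomial.X (some i)) = zF i := toFF_z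
        have h2 := swapP_z a b i
        unfold zP at h2
        simp only [RingHom.comp_apply, RingHom.coe_coe]
        rw [h2, h1, h1, sigmaF_z]
  exact congrArg (fun g => g P) h

theorem zF_ne {r : ℕ} (a b : Fin r) (h : a ≠ b) : zF a - zF b ≠ 0 := by
  rw [sub_ne_zero]
  intro h1
  exact h (MvPolynomial.X_injective (IsFractionRing.injective _ _ h1))

theorem zP_ne {r : ℕ} (a : Fin r) : zP a ≠ 0 := MvPolynomial.X_ne_zero _

theorem inv_lt_of_count {r : ℕ} (a b : Fin r) (hab : b.val = a.val + 1)
    (w : Equiv.Perm (Fin r)) (h : invCount (Equiv.swap a b * w) > invCount w) :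
    w⁻¹ a < w⁻¹ b := by
  have hne : a ≠ b := by intro h; rw [h] at hab; omega
  by_contra hc
  have hc2 : w⁻¹ b < w⁻¹ a := lt_of_le_of_ne (not_lt.mp hc)
    (fun h => hne (w⁻¹.injective h).symm)
  refine absurd h (not_lt.mpr ?_)
  unfold invCount
  refine Finset.card_le_card (Finset.subset_iff.mpr ?_)
  intro x hp
  obtain ⟨p, q⟩ := x
  rw [Finset.mem_filter] at hp ⊢
  simp only [Finset.mem_univ, true_and, Equiv.Perm.mul_apply] at hp ⊢
  refine ⟨hp.1, ?_⟩
  obtain ⟨h1, h2⟩ := hp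
  by_contra h3
  have hpq : w p ≠ w q := fun h => h1.ne (w.injective h)
  rw [Equiv.swap_apply_def, Equiv.swap_apply_def] at h2
  by_cases hp1 : w p = a
  · by_cases hq1 : w q = b
    · rw [← hp1, ← hq1] at hc2
      simp at hc2
      exact absurd hc2 (not_lt.mpr h1.le)
    · have hq2 : w q ≠ a := fun h => hpq (hp1.trans h.symm)
      rw [if_pos hp1, if_neg hq2, if_neg hq1] at h2
      rw [Fin.lt_def] at h2 h3
      have := Fin.val_ne_of_ne hq2
      rw [hp1] at h3
      omega
  · simp only [hp1, if_false] at h2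
    have e1 := Fin.val_ne_of_ne hp1
    rw [Fin.lt_def] at h2 h3
    split_ifs at h2 <;> simp only [Fin.ext_iff] at * <;> omega

theorem main_poly {r N : ℕ} (lam : Fin r → ℕ) (w1 w2 w3 w4 : Equiv.Perm (Fin r))
    (a b : Fin r) (hab : b.val = a.val + 1) (h1 : w1⁻¹ a < w1⁻¹ b) (h2 : w2⁻¹ a < w2⁻¹ b) :
    (1 - tP r) * zP b * partitionZ r N lam w1 w2 w3 w4
      + tP r * (zP a - zP b) * partitionZ r N lam w1 (Equiv.swap a b * w2) w3 w4
    = (1 - tP r) * zP b * swapP a b (partitionZ r N lam w1 w2 w3 w4)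
      + tP r * (zP a - zP b) * swapP a b (partitionZ r N lam (Equiv.swap a b * w1) w2 w3 w4) := by
  have h := Zgen_YBE (N := N) (topM N lam w3 w4) zP (fun i => Sum.inr (w2⁻¹ i))
    (fun i => Sum.inl (w1⁻¹ i)) a b hab
  have hz : ∀ l ρ : Fin r → Spin r, swapP a b (Zgen (topM N lam w3 w4) zP l ρ)
      = Zgen (topM N lam w3 w4) (zP ∘ Equiv.swap a b) l ρ := by
    intro l ρ
    rw [Zgen_map _ (swapP_t a b)]
    simp only [swapP_z]
    rfl
  have e1 : (fun i => (Sum.inr ((Equiv.swap a b * w2)⁻¹ i) : Spin r))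
      = (fun i => Sum.inr (w2⁻¹ i)) ∘ Equiv.swap a b := by
    funext i; simp [mul_inv_rev]
  have e2 : (fun i => (Sum.inl ((Equiv.swap a b * w1)⁻¹ i) : Spin r))
      = (fun i => Sum.inl (w1⁻¹ i)) ∘ Equiv.swap a b := by
    funext i; simp [mul_inv_rev]
  rw [partitionZ_eq, partitionZ_eq, partitionZ_eq, e1, e2, hz, hz]
  have hc : (zP a * zP b : PolyR r) ≠ 0 := mul_ne_zero (zP_ne a) (zP_ne b)
  apply mul_left_cancel₀ hc
  have g1 : rhoR (zP a) (zP b) 0 0 0 (Sum.inr (w2⁻¹ a)) (Sum.inr (w2⁻¹ b))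
      = zP a * zP b * ((1 - tP r) * zP b) := by
    simp only [rhoR, rk, Nat.zero_le, if_true]
    rw [if_neg h2.ne, if_pos (Fin.lt_def.mp h2)]
  have g2 : offR (zP a) (zP b) (Sum.inr (w2⁻¹ a)) (Sum.inr (w2⁻¹ b))
      = zP a * zP b * (tP r * (zP a - zP b)) := by
    simp only [offR]
    rw [if_neg h2.ne, if_neg (not_lt.mpr h2.le)]
  have g3 : rhoR (zP a) (zP b) 0 0 0 (Sum.inl (w1⁻¹ a)) (Sum.inl (w1⁻¹ b))
      = zP a * zP b * ((1 - tP r) * zP b) := by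
    simp only [rhoR, rk, Nat.zero_le, if_true]
    rw [if_neg h1.ne, if_pos (Fin.lt_def.mp h1)]
  have g4 : offR (zP a) (zP b) (Sum.inl (w1⁻¹ b)) (Sum.inl (w1⁻¹ a))
      = zP a * zP b * (tP r * (zP a - zP b)) := by
    simp only [offR]
    rw [if_neg h1.ne', if_neg (not_lt.mpr h1.le)]
  rw [g1, g2, g3, g4] at h
  linear_combination h

end Final

/-- if ℓ(s w₁) > ℓ(w₁) and ℓ(s w₂) > ℓ(w₂) then (1-t)·D⁽⁴⁾(Z(w₁,w₂)) = t·σ(Z(s w₁, w₂)) − t·Z(w₁, s w₂). -/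
theorem stmt13 (r N : ℕ) (hr : 2 ≤ r) (hN : 1 ≤ N)
    (lam : Fin r → ℕ)
    (hpart : ∀ i j : Fin r, i ≤ j → lam j ≤ lam i)
    (hlam1 : lam ⟨0, by omega⟩ ≤ N - 1)
    (w3 w4 : Equiv.Perm (Fin r))
    (w1 w2 : Equiv.Perm (Fin r))
    (i : ℕ) (h1 : 1 ≤ i) (h2 : i ≤ r - 1) :
    let a : Fin r := ⟨i - 1, by omega⟩
    let b : Fin r := ⟨i, by omega⟩
    let s : Equiv.Perm (Fin r) := Equiv.swap a b
    let Z : Equiv.Perm (Fin r) → Equiv.Perm (Fin r) → FFld r := fun u v =>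
      toFF r (partitionZ r N lam u v w3 w4)
    invCount (s * w1) > invCount w1 →
    invCount (s * w2) > invCount w2 →
    (1 - tF r) * DF4 a b (Z w1 w2) = tF r * sigmaF a b (Z (s * w1) w2) - tF r * Z w1 (s * w2) := by
  intro a b s Z hi1 hi2
  have hab : b.val = a.val + 1 := by
    change i = i - 1 + 1
    omega
  have hne : a ≠ b := by intro h; rw [h] at hab; omega
  have h := main_poly (N := N) lam w1 w2 w3 w4 a b hab (inv_lt_of_count a b hab w1 hi1)
    (inv_lt_of_count a b hab w2 hi2)
  have h' := congrArg (toFF r) h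
  simp only [map_add, map_mul, map_sub, map_one, toFF_t, toFF_z, ← sigmaF_toFF] at h'
  have hz := zF_ne a b hne
  unfold DF4
  apply mul_left_cancel₀ hz
  have hcan : (zF a - zF b) * (zF a - zF b)⁻¹ = 1 := mul_inv_cancel₀ hz
  change _ = (zF a - zF b) * (tF r * sigmaF a b (toFF r (partitionZ r N lam (s * w1) w2 w3 w4))
    - tF r * toFF r (partitionZ r N lam w1 (s * w2) w3 w4))
  change (zF a - zF b) * ((1 - tF r) * ((zF a - zF b)⁻¹ *
    (zF b * toFF r (partitionZ r N lam w1 w2 w3 w4)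
      - zF b * sigmaF a b (toFF r (partitionZ r N lam w1 w2 w3 w4))))) = _
  linear_combination h' + (1 - tF r) * (zF b * toFF r (partitionZ r N lam w1 w2 w3 w4)
      - zF b * sigmaF a b (toFF r (partitionZ r N lam w1 w2 w3 w4))) * hcan
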